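/- arXiv:2502.16355 — 5 statements merged into one kernel-verified Lean document; each statement's English description precedes it below -/
import Mathlib

section
/- There exist an absolute constant c > 0 and n₀ ∈ ℕ such that for all n ≥ n₀, all ε ∈ (0,1], and every subset N ⊆ {1,…,n} with |N| ≥ √n/2, the following holds. Let p be the product probability distribution on {-1,1}^n whose i-th coordinate has mean ε/n^{1/4} for i ∈ N and mean 0 for i ∉ N (i.e., coordinate i equals 1 with probability (1+μ_i)/2 where μ_i = ε/n^{1/4} for i ∈ N and μ_i = 0 otherwise). Then the total variation distance between p and the uniform distribution on {-1,1}^n is at least c·ε. -/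
open Finset

/-- The product distribution on `{-1,1}^n` (encoded as `Fin n → Bool`, with `true`
playing the role of `1` and `false` the role of `-1`) with mean vector `μ`:
coordinate `i` equals `1` with probability `(1 + μ i)/2`. -/
noncomputable def prodDist (n : ℕ) (μ : Fin n → ℝ) (x : Fin n → Bool) : ℝ :=
  ∏ j : Fin n, (if x j then (1 + μ j) / 2 else (1 - μ j) / 2)

/-- The uniform distribution on `{-1,1}^n`. -/
noncomputable def unifDist (n : ℕ) : (Fin n → Bool) → ℝ := fun _ => (1 / 2) ^ n

/-- Total variation distance between two distributions on `{-1,1}^n`. -/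
noncomputable def tvDist (n : ℕ) (p q : (Fin n → Bool) → ℝ) : ℝ :=
  (1 / 2) * ∑ x : Fin n → Bool, |p x - q x|

open Complex in
lemma aux_im (y : ℝ) (hy : 0 ≤ y) (k : ℕ) : (k:ℝ) * y ≤ 1 →
    (1 - (k * y)^2 ≤ ((1 + y * I : ℂ)^k).re ∧ ((1 + y * I : ℂ)^k).re ≤ 1) ∧
    (k * y * (1 - (k*y)^2) ≤ ((1 + y * I : ℂ)^k).im ∧ ((1 + y * I : ℂ)^k).im ≤ k * y) := by
  induction k with
  | zero => intro _; simp
  | succ k ih =>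
    intro h
    push_cast at h ⊢
    have hk : (0:ℝ) ≤ k := Nat.cast_nonneg k
    have h1 : (k:ℝ) * y ≤ 1 := by nlinarith
    obtain ⟨⟨a1, a2⟩, b1, b2⟩ := ih h1
    rw [pow_succ (1 + y * I : ℂ) k]
    generalize (1 + y * I : ℂ)^k = z at *
    have hre : (z * (1 + y * I)).re = z.re - y * z.im := by simp; ring
    have him : (z * (1 + y * I)).im = z.im + y * z.re := by simp; ring
    rw [hre, him]
    have hky : 0 ≤ (k:ℝ) * y := by positivity
    have hsq : ((k:ℝ) * y)^2 ≤ 1 := by nlinarith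
    have h0 : 0 ≤ z.im := le_trans (mul_nonneg hky (by linarith)) b1
    have e1 : y * z.im ≤ y * (k * y) := mul_le_mul_of_nonneg_left b2 hy
    have e2 : 0 ≤ y * z.im := mul_nonneg hy h0
    have e3 : y * z.re ≤ y * 1 := mul_le_mul_of_nonneg_left a2 hy
    have e4 : y * (1 - (k * y)^2) ≤ y * z.re := mul_le_mul_of_nonneg_left a1 hy
    have e5 : ((k:ℝ) * y)^2 ≤ (((k:ℝ)+1) * y)^2 := by gcongr; linarith
    have e6 : ((k:ℝ)+1) * y * (1 - (((k:ℝ)+1) * y)^2) ≤ ((k:ℝ)+1) * y * (1 - (k * y)^2) := by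
      gcongr
    refine ⟨⟨?_, ?_⟩, ?_, ?_⟩
    · nlinarith [sq_nonneg y, mul_nonneg hk (sq_nonneg y)]
    · linarith
    · linarith
    · linarith

open Complex in
noncomputable def auxW (n : ℕ) (M : Finset (Fin n)) (t : ℝ) (x : Fin n → Bool) : ℂ :=
  ∏ j : Fin n, (if j ∈ M then 1 + ((if x j then t else -t : ℝ) : ℂ) * I else 1)

open Complex in
lemma aux_sum (n : ℕ) (M : Finset (Fin n)) (t : ℝ) (μ : Fin n → ℝ) :
    ∑ x : Fin n → Bool, (prodDist n μ x : ℂ) * auxW n M t x =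
      ∏ j : Fin n, (if j ∈ M then 1 + ((t * μ j : ℝ) : ℂ) * I else 1) := by
  have : ∀ j : Fin n, (if j ∈ M then 1 + ((t * μ j : ℝ) : ℂ) * I else 1) =
      ∑ b : Bool, (((if b then (1 + μ j) / 2 else (1 - μ j) / 2 : ℝ) : ℂ) *
        (if j ∈ M then 1 + ((if b then t else -t : ℝ) : ℂ) * I else 1)) := by
    intro j
    by_cases h : j ∈ M <;> simp [h] <;> ring
  simp_rw [this]
  rw [Finset.prod_univ_sum, Fintype.piFinset_univ]
  refine Finset.sum_congr rfl fun x _ => ?_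
  rw [Finset.prod_mul_distrib, prodDist, auxW]
  push_cast
  rfl

open Complex in
lemma aux_norm (n : ℕ) (M : Finset (Fin n)) (t : ℝ) (h : M.card * t^2 ≤ 1) (x : Fin n → Bool) :
    ‖auxW n M t x‖ ≤ 2 := by
  have h1 : ‖auxW n M t x‖^2 = (1 + t^2)^M.card := by
    rw [auxW, norm_prod, ← Finset.prod_pow]
    have : ∀ j : Fin n, ‖(if j ∈ M then 1 + ((if x j then t else -t : ℝ) : ℂ) * I else 1)‖^2
        = if j ∈ M then 1 + t^2 else 1 := by
      intro j
      by_cases hj : j ∈ M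
      · simp only [hj, if_true]
        rw [← Complex.normSq_eq_norm_sq, Complex.normSq_apply]
        cases x j <;> simp <;> ring
      · simp [hj]
    simp_rw [this]
    rw [Finset.prod_ite_mem]
    simp
  have h2 : (1 + t^2)^M.card ≤ Real.exp 1 := by
    calc (1 + t^2)^M.card ≤ (Real.exp (t^2))^M.card := by
          gcongr
          linarith [Real.add_one_le_exp (t^2)]
      _ = Real.exp (M.card * t^2) := by rw [← Real.exp_nat_mul]
      _ ≤ _ := Real.exp_le_exp.2 h
  have := Real.exp_one_lt_d9
  nlinarith [norm_nonneg (auxW n M t x)]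

lemma aux_unif (n : ℕ) : unifDist n = prodDist n (fun _ => 0) := by
  funext x
  simp [unifDist, prodDist]

/-- there exist `c > 0` and `n₀` such that for all `n ≥ n₀`, all
`ε ∈ (0,1]` and every `N ⊆ [n]` with `|N| ≥ √n / 2`, the product distribution on
`{-1,1}^n` whose coordinate means are `ε / n^(1/4)` on `N` and `0` off `N` is at
total variation distance at least `c · ε` from the uniform distribution. -/
theorem stmt1 : ∃ c : ℝ, 0 < c ∧ ∃ n₀ : ℕ, ∀ n : ℕ, n₀ ≤ n →
    ∀ ε : ℝ, 0 < ε → ε ≤ 1 → ∀ N : Finset (Fin n),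
    Real.sqrt n / 2 ≤ (N.card : ℝ) →
    c * ε ≤ tvDist n
      (prodDist n (fun i => if i ∈ N then ε / (n : ℝ) ^ ((1 : ℝ) / 4) else 0))
      (unifDist n) := by
  refine ⟨1/32, by norm_num, 16, ?_⟩
  intro n hn ε hε hε1 N hN
  have hn' : (16:ℝ) ≤ n := by exact_mod_cast hn
  set s := Real.sqrt n with hs
  have hs4 : 4 ≤ s := by
    rw [hs]; apply Real.le_sqrt_of_sq_le; norm_num; exact hn
  set r := (n:ℝ) ^ ((1:ℝ)/4) with hr
  have hr0 : 0 < r := by positivity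
  have hrr : r^2 = s := by
    rw [hr, hs, Real.sqrt_eq_rpow, ← Real.rpow_natCast, ← Real.rpow_mul (by positivity)]
    norm_num
  have hle : ⌈s/2⌉₊ ≤ N.card := Nat.ceil_le.2 hN
  obtain ⟨M, hMN, hM⟩ := Finset.exists_subset_card_eq hle
  have hk1 : s/2 ≤ (M.card:ℝ) := by rw [hM]; exact Nat.le_ceil _
  have hk2 : (M.card:ℝ) ≤ 3/4 * s := by
    rw [hM]; have := Nat.ceil_lt_add_one (a := s/2) (by positivity); linarith
  set μ : Fin n → ℝ := fun i => if i ∈ N then ε / r else 0 with hμ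
  set t : ℝ := 1 / r with ht
  have ht2 : t^2 = 1 / s := by rw [ht, div_pow, hrr]; simp
  have hs0 : 0 < s := by linarith
  have hkt : M.card * t^2 ≤ 1 := by
    rw [ht2, mul_one_div, div_le_one hs0]; linarith
  have hP := aux_sum n M t μ
  have hQ := aux_sum n M t (fun _ => 0)
  rw [← aux_unif] at hQ
  have hQ' : ∑ x : Fin n → Bool, (unifDist n x : ℂ) * auxW n M t x = 1 := by
    rw [hQ]; simp
  have hP' : ∑ x : Fin n → Bool, (prodDist n μ x : ℂ) * auxW n M t x
      = (1 + ((ε / s : ℝ) : ℂ) * Complex.I)^M.card := by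
    rw [hP, Finset.prod_ite_mem, Finset.univ_inter, ← Finset.prod_const]
    refine Finset.prod_congr rfl fun j hj => ?_
    have : t * μ j = ε / s := by
      simp only [hμ, if_pos (hMN hj), ht, ← hrr]
      field_simp
    rw [this]
  have hy1 : ε / 2 ≤ M.card * (ε / s) := by
    rw [mul_div_assoc', le_div_iff₀ hs0]; nlinarith
  have hy2 : M.card * (ε / s) ≤ 3/4 := by
    rw [mul_div_assoc', div_le_iff₀ hs0]; nlinarith
  have him := (aux_im (ε / s) (by positivity) M.card (by linarith)).2.1
  rw [← hP'] at him
  set y := (M.card:ℝ) * (ε / s) with hy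
  have hbig : ε / 2 * (7/16) ≤ y * (1 - y^2) := by
    apply mul_le_mul hy1 _ (by norm_num) (by linarith)
    nlinarith
  have hdiff : ‖∑ x : Fin n → Bool, ((prodDist n μ x - unifDist n x : ℝ) : ℂ) * auxW n M t x‖
      ≤ ∑ x : Fin n → Bool, |prodDist n μ x - unifDist n x| * 2 := by
    refine (norm_sum_le _ _).trans (Finset.sum_le_sum fun x _ => ?_)
    rw [norm_mul, Complex.norm_real, Real.norm_eq_abs]
    exact mul_le_mul_of_nonneg_left (aux_norm n M t hkt x) (abs_nonneg _)
  have hE : ∑ x : Fin n → Bool, ((prodDist n μ x - unifDist n x : ℝ) : ℂ) * auxW n M t x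
      = ∑ x : Fin n → Bool, (prodDist n μ x : ℂ) * auxW n M t x - 1 := by
    rw [← hQ', ← Finset.sum_sub_distrib]
    refine Finset.sum_congr rfl fun x _ => ?_
    push_cast; ring
  rw [hE, ← Finset.sum_mul] at hdiff
  have h3 := (Complex.abs_im_le_norm _).trans hdiff
  rw [Complex.sub_im, Complex.one_im, sub_zero] at h3
  have h4 := (le_abs_self _).trans h3
  rw [tvDist]
  linarith
end

section
/- Let n ≥ 1, ε ∈ (0,1], set a = ε/n^{1/4}, and let N ⊆ {1,…,n}. Let p be the product probability distribution on {-1,1}^n whose i-th coordinate has mean a for i ∈ N and mean 0 for i ∉ N. For x ∈ {-1,1}^n, let t(x) denote the number of coordinates i ∈ N with x_i = 1. Then the total variation distance between p and the uniform distribution on {-1,1}^n is at least 2^{-n} · Σ over all x ∈ {-1,1}^n with 2·t(x) ≤ |N| of the quantity (1 − (1−a)^(|N| − 2·t(x))). -/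
open Finset

/-- Number of coordinates `i ∈ N` with `x i = 1`. -/
def tCount (n : ℕ) (N : Finset (Fin n)) (x : Fin n → Bool) : ℕ :=
  (N.filter fun i => x i).card

lemma sum_prodDist (n : ℕ) (μ : Fin n → ℝ) : ∑ x, prodDist n μ x = 1 := by
  unfold prodDist
  have h := Finset.prod_univ_sum (fun _ : Fin n => (Finset.univ : Finset Bool))
    (fun j b => (if b then (1 + μ j) / 2 else (1 - μ j) / 2 : ℝ))
  rw [Fintype.piFinset_univ] at h
  rw [← h]
  apply Finset.prod_eq_one
  intro i _
  simp
  ring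

lemma sum_unifDist (n : ℕ) : ∑ x, unifDist n x = 1 := by
  simp [unifDist]

lemma prodDist_eq (n : ℕ) (a : ℝ) (N : Finset (Fin n)) (x : Fin n → Bool) :
    prodDist n (fun i => if i ∈ N then a else 0) x =
      (1 / 2) ^ n * ((1 + a) ^ tCount n N x * (1 - a) ^ (N.card - tCount n N x)) := by
  have h1 : prodDist n (fun i => if i ∈ N then a else 0) x =
      ∏ j : Fin n, ((1 / 2 : ℝ) * (if j ∈ N then (if x j then 1 + a else 1 - a) else 1)) := by
    unfold prodDist
    apply Finset.prod_congr rfl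
    intro j _
    by_cases hx : x j = true <;> by_cases hN : j ∈ N <;> simp only [hx, hN, if_true, if_false, Bool.false_eq_true] <;> ring
  have h2 : (N.filter fun i => ¬ (x i = true)).card = N.card - tCount n N x := by
    have := Finset.card_filter_add_card_filter_not (s := N) (fun i => x i = true)
    unfold tCount
    omega
  rw [h1, Finset.prod_mul_distrib, Finset.prod_ite_mem, Finset.univ_inter, Finset.prod_ite,
    Finset.prod_const, Finset.prod_const, Finset.prod_const, h2]
  simp [tCount]

lemma tv_ge (n : ℕ) (p q : (Fin n → Bool) → ℝ) (hp : ∑ x, p x = 1) (hq : ∑ x, q x = 1)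
    (A : Finset (Fin n → Bool)) : ∑ x ∈ A, (q x - p x) ≤ tvDist n p q := by
  have h0 : ∑ x, (q x - p x) = 0 := by rw [Finset.sum_sub_distrib, hp, hq]; ring
  have h1 := Finset.sum_add_sum_compl A (fun x => q x - p x)
  have h2 := Finset.sum_add_sum_compl A (fun x => |p x - q x|)
  have h3 : ∑ x ∈ A, (q x - p x) ≤ ∑ x ∈ A, |p x - q x| :=
    Finset.sum_le_sum fun x _ => by rw [abs_sub_comm]; exact le_abs_self _
  have h4 : ∑ x ∈ Aᶜ, -(q x - p x) ≤ ∑ x ∈ Aᶜ, |p x - q x| :=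
    Finset.sum_le_sum fun x _ => by rw [neg_sub]; exact le_abs_self _
  rw [Finset.sum_neg_distrib] at h4
  unfold tvDist
  linarith

/-- with `a = ε / n^(1/4)` and `p` the product distribution whose
coordinate means are `a` on `N` and `0` off `N`, the total variation distance
between `p` and uniform is at least
`2^{-n} · Σ_{x : 2 t(x) ≤ |N|} (1 - (1-a)^(|N| - 2 t(x)))`. -/
theorem stmt2 (n : ℕ) (hn : 1 ≤ n) (ε : ℝ) (hε0 : 0 < ε) (hε1 : ε ≤ 1)
    (N : Finset (Fin n)) :
    (1 / 2 : ℝ) ^ n *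
      ∑ x ∈ Finset.univ.filter
          (fun x : Fin n → Bool => 2 * tCount n N x ≤ N.card),
        (1 - (1 - ε / (n : ℝ) ^ ((1 : ℝ) / 4)) ^ (N.card - 2 * tCount n N x)) ≤
    tvDist n
      (prodDist n (fun i => if i ∈ N then ε / (n : ℝ) ^ ((1 : ℝ) / 4) else 0))
      (unifDist n) := by
  have hn' : (1 : ℝ) ≤ (n : ℝ) ^ ((1 : ℝ) / 4) :=
    Real.one_le_rpow (by exact_mod_cast hn) (by norm_num)
  have ha0 : 0 ≤ ε / (n : ℝ) ^ ((1 : ℝ) / 4) := by positivity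
  have ha1 : ε / (n : ℝ) ^ ((1 : ℝ) / 4) ≤ 1 := by
    rw [div_le_one (by linarith)]; linarith
  generalize ε / (n : ℝ) ^ ((1 : ℝ) / 4) = a at ha0 ha1
  refine le_trans ?_ (tv_ge n _ _ (sum_prodDist n _) (sum_unifDist n)
    (Finset.univ.filter (fun x : Fin n → Bool => 2 * tCount n N x ≤ N.card)))
  rw [Finset.mul_sum]
  apply Finset.sum_le_sum
  intro x hx
  have hx' := (Finset.mem_filter.mp hx).2
  rw [prodDist_eq, unifDist]
  generalize tCount n N x = t at hx'
  have e : N.card - t = t + (N.card - 2 * t) := by omega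
  rw [e, pow_add, ← mul_assoc ((1 + a) ^ t), ← mul_pow]
  have k1 : ((1 + a) * (1 - a)) ^ t ≤ 1 := pow_le_one₀ (by nlinarith) (by nlinarith)
  have k2 : 0 ≤ (1 - a) ^ (N.card - 2 * t) := pow_nonneg (by linarith) _
  have k3 := mul_le_mul_of_nonneg_right k1 k2
  have k4 : (0 : ℝ) ≤ (1 / 2) ^ n := by positivity
  have k5 := mul_le_mul_of_nonneg_left k3 k4
  linarith
end

section
/- There exist an absolute constant c > 0 and n₀ ∈ ℕ such that for all n ≥ n₀ and all ε ∈ (0,1], the following holds. Let μ be a random vector in ℝ^n whose coordinates are independent, each equal to ε/n^{1/4} with probability 1/√n and equal to 0 otherwise, and let p_μ be the product distribution on {-1,1}^n with mean vector μ. Then with probability at least 1 − e^{−√n/8} − 1/n over the draw of μ, the total variation distance between p_μ and the uniform distribution on {-1,1}^n is at least c·ε. -/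
open Finset

lemma aux_binom (z : ℂ) (k : ℕ) :
    ‖(1 + z) ^ k - 1 - k * z‖ ≤ (1 + ‖z‖) ^ k - 1 - k * ‖z‖ := by
  induction k with
  | zero => simp
  | succ k ih =>
    have e : (1 + z) ^ (k+1) - 1 - ((k+1 : ℕ) : ℂ) * z
        = (1 + z) * ((1 + z) ^ k - 1 - k * z) + k * z ^ 2 := by
      push_cast; ring
    have h1 : ‖1 + z‖ ≤ 1 + ‖z‖ := by
      simpa using norm_add_le (1 : ℂ) z
    rw [e]
    calc _ ≤ ‖(1 + z) * ((1 + z) ^ k - 1 - k * z)‖ + ‖(k : ℂ) * z ^ 2‖ := norm_add_le _ _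
      _ = ‖1 + z‖ * ‖(1 + z) ^ k - 1 - k * z‖ + k * ‖z‖ ^ 2 := by simp
      _ ≤ (1 + ‖z‖) * ((1 + ‖z‖) ^ k - 1 - k * ‖z‖) + k * ‖z‖ ^ 2 := by gcongr
      _ = _ := by push_cast; ring

lemma aux_low (u : ℝ) (k : ℕ) (hu : 0 ≤ u) (hk : k * u ≤ 1 / 2) :
    k * u / 2 ≤ ‖(1 + (u : ℂ) * Complex.I) ^ k - 1‖ := by
  have h := aux_binom ((u : ℂ) * Complex.I) k
  have hn : ‖(u : ℂ) * Complex.I‖ = u := by simp [abs_of_nonneg hu]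
  rw [hn] at h
  have h0 : 0 ≤ k * u := by positivity
  have h2 : (1 + u) ^ k ≤ Real.exp (k * u) := by
    rw [Real.exp_nat_mul]
    gcongr
    linarith [Real.add_one_le_exp u]
  have h3 := (abs_le.1 (Real.abs_exp_sub_one_sub_id_le (x := k * u)
    (by rw [abs_of_nonneg h0]; linarith))).2
  have h4 : ‖(k : ℂ) * ((u : ℂ) * Complex.I)‖ = k * u := by
    rw [norm_mul, hn]; simp
  have h5 := norm_sub_norm_le ((k : ℂ) * ((u : ℂ) * Complex.I))
    (-((1 + (u : ℂ) * Complex.I) ^ k - 1 - k * ((u : ℂ) * Complex.I)))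
  rw [norm_neg, h4, sub_neg_eq_add] at h5
  have e : (k : ℂ) * ((u : ℂ) * Complex.I) +
    ((1 + (u : ℂ) * Complex.I) ^ k - 1 - k * ((u : ℂ) * Complex.I)) =
    (1 + (u : ℂ) * Complex.I) ^ k - 1 := by ring
  rw [e] at h5
  nlinarith

/-- test factor -/
noncomputable def tstF {n : ℕ} (S : Finset (Fin n)) (θ : ℝ) (j : Fin n) (b : Bool) : ℂ :=
  if j ∈ S then (if b then 1 + (θ : ℂ) * Complex.I else 1 - (θ : ℂ) * Complex.I) else 1

lemma aux_expect {n : ℕ} (S : Finset (Fin n)) (θ t : ℝ) :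
    ∑ x : Fin n → Bool, (prodDist n (fun i => if i ∈ S then t else 0) x : ℂ)
      * ∏ j, tstF S θ j (x j) = (1 + ((θ * t : ℝ) : ℂ) * Complex.I) ^ S.card := by
  have h := Finset.prod_univ_sum (fun _ : Fin n => (Finset.univ : Finset Bool))
    (fun j b => (((if b then (1 + (if j ∈ S then t else 0)) / 2
      else (1 - (if j ∈ S then t else 0)) / 2 : ℝ)) : ℂ) * tstF S θ j b)
  rw [Fintype.piFinset_univ] at h
  simp only [prodDist, Complex.ofReal_prod, ← Finset.prod_mul_distrib]
  rw [← h]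
  have : ∀ j : Fin n, (∑ b : Bool, (((if b then (1 + (if j ∈ S then t else 0)) / 2
      else (1 - (if j ∈ S then t else 0)) / 2 : ℝ)) : ℂ) * tstF S θ j b)
      = if j ∈ S then (1 + ((θ * t : ℝ) : ℂ) * Complex.I) else 1 := by
    intro j
    by_cases hj : j ∈ S
    · simp [tstF, hj]; ring
    · simp [tstF, hj]
  simp only [this]
  rw [Finset.prod_ite_mem]
  simp

lemma aux_unif_s5 {n : ℕ} (S : Finset (Fin n)) (x : Fin n → Bool) :
    unifDist n x = prodDist n (fun i => if i ∈ S then 0 else 0) x := by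
  simp [unifDist, prodDist]

lemma aux_norm_s5 {n : ℕ} (S : Finset (Fin n)) (θ : ℝ) (x : Fin n → Bool) :
    ‖∏ j, tstF S θ j (x j)‖ ≤ Real.exp (S.card * θ ^ 2 / 2) := by
  have hb : ‖1 + (θ : ℂ) * Complex.I‖ ≤ Real.exp (θ ^ 2 / 2) := by
    have h1 : ‖1 + (θ : ℂ) * Complex.I‖ ^ 2 = 1 + θ ^ 2 := by
      rw [← Complex.normSq_eq_norm_sq]; simp [Complex.normSq_apply]; ring
    have h2 : Real.exp (θ ^ 2 / 2) ^ 2 = Real.exp (θ ^ 2) := by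
      rw [← Real.exp_nat_mul]; congr 1; push_cast; ring
    apply le_of_sq_le_sq _ (Real.exp_pos _).le
    rw [h1, h2]; linarith [Real.add_one_le_exp (θ ^ 2)]
  have hb' : ‖1 - (θ : ℂ) * Complex.I‖ ≤ Real.exp (θ ^ 2 / 2) := by
    have h1 : ‖1 - (θ : ℂ) * Complex.I‖ ^ 2 = 1 + θ ^ 2 := by
      rw [← Complex.normSq_eq_norm_sq]; simp [Complex.normSq_apply]; ring
    have h2 : Real.exp (θ ^ 2 / 2) ^ 2 = Real.exp (θ ^ 2) := by
      rw [← Real.exp_nat_mul]; congr 1; push_cast; ring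
    apply le_of_sq_le_sq _ (Real.exp_pos _).le
    rw [h1, h2]; linarith [Real.add_one_le_exp (θ ^ 2)]
  rw [norm_prod]
  calc _ ≤ ∏ j, (if j ∈ S then Real.exp (θ ^ 2 / 2) else 1) := by
        apply Finset.prod_le_prod
        · intros; positivity
        · intro j _
          by_cases hj : j ∈ S
          · cases hx : x j <;> simp [tstF, hj, hb, hb']
          · simp [tstF, hj]
    _ = _ := by
        rw [Finset.prod_ite_mem]
        simp only [Finset.univ_inter, Finset.prod_const]
        rw [← Real.exp_nat_mul]; congr 1; ring

lemma aux_tv {n : ℕ} (S : Finset (Fin n)) (θ t : ℝ) (hθ : 0 ≤ θ) (ht : 0 ≤ t)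
    (h1 : S.card * (θ * t) ≤ 1 / 2) (h2 : S.card * θ ^ 2 ≤ 1) :
    S.card * (θ * t) / 8 ≤
      tvDist n (prodDist n (fun i => if i ∈ S then t else 0)) (unifDist n) := by
  have hl := aux_low (θ * t) S.card (by positivity) h1
  have e0 := aux_expect S θ 0
  rw [← aux_expect S θ t] at hl
  simp only [← aux_unif_s5, mul_zero, Complex.ofReal_zero, zero_mul, add_zero, one_pow] at e0
  rw [← e0, ← Finset.sum_sub_distrib] at hl
  have hexp : Real.exp (S.card * θ ^ 2 / 2) ≤ 2 := by
    have a : Real.exp (S.card * θ ^ 2 / 2) ≤ Real.exp (1/2) := Real.exp_le_exp.2 (by linarith)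
    have b : Real.exp (1/2) ^ 2 = Real.exp 1 := by
      rw [← Real.exp_nat_mul]; norm_num
    have := Real.exp_one_lt_d9
    nlinarith [Real.exp_pos (1/2)]
  have hu : ‖∑ x : Fin n → Bool, ((prodDist n (fun i => if i ∈ S then t else 0) x : ℂ)
      * ∏ j, tstF S θ j (x j) - (unifDist n x : ℂ) * ∏ j, tstF S θ j (x j))‖ ≤
      ∑ x : Fin n → Bool, |prodDist n (fun i => if i ∈ S then t else 0) x - unifDist n x| * 2 := by
    refine (norm_sum_le _ _).trans (Finset.sum_le_sum fun x _ => ?_)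
    rw [← sub_mul, norm_mul, ← Complex.ofReal_sub, Complex.norm_real, Real.norm_eq_abs]
    exact mul_le_mul_of_nonneg_left ((aux_norm_s5 S θ x).trans hexp) (abs_nonneg _)
  rw [← Finset.sum_mul] at hu
  unfold tvDist
  linarith

lemma aux_good {n : ℕ} (hn : 1 ≤ n) (ε : ℝ) (h0 : 0 < ε) (h1 : ε ≤ 1) (S : Finset (Fin n))
    (hS : Real.sqrt n / 4 ≤ S.card) :
    1 / 16 * ε ≤ tvDist n
      (prodDist n (fun i => if i ∈ S then ε / (n : ℝ) ^ ((1 : ℝ) / 4) else 0)) (unifDist n) := by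
  have hn' : (0 : ℝ) < n := by exact_mod_cast hn
  have hs : 0 < Real.sqrt n := Real.sqrt_pos.2 hn'
  have hk : (0 : ℝ) < S.card := by linarith
  set r : ℝ := (n : ℝ) ^ ((1 : ℝ) / 4) with hr
  have hrp : 0 < r := by positivity
  have hr2 : r ^ 2 = Real.sqrt n := by
    rw [hr, ← Real.rpow_natCast, ← Real.rpow_mul hn'.le, Real.sqrt_eq_rpow]; norm_num
  have e : S.card * (r / (2 * S.card) * (ε / r)) = ε / 2 := by field_simp
  have e2 : S.card * (r / (2 * S.card)) ^ 2 = Real.sqrt n / 4 / S.card := by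
    rw [← hr2]; field_simp; norm_num
  have := aux_tv S (r / (2 * S.card)) (ε / r) (by positivity) (by positivity)
    (by rw [e]; linarith) (by rw [e2]; exact (div_le_one hk).2 hS)
  rw [e] at this
  linarith

lemma aux_bad {n : ℕ} (hn : 1 ≤ n) :
    ∑ S ∈ Finset.univ.filter (fun S : Finset (Fin n) => ¬ Real.sqrt n / 4 ≤ S.card),
      (1 / Real.sqrt n) ^ S.card * (1 - 1 / Real.sqrt n) ^ (n - S.card)
      ≤ Real.exp (-(Real.sqrt n) / 8) := by
  have hn' : (1 : ℝ) ≤ n := by exact_mod_cast hn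
  have hs : 1 ≤ Real.sqrt n := Real.one_le_sqrt.2 hn'
  have hss : Real.sqrt n * Real.sqrt n = n := Real.mul_self_sqrt (by linarith)
  set s := Real.sqrt n with hsdef
  have hp1 : 1 / s ≤ 1 := (div_le_one (by linarith)).2 hs
  have hp0 : 0 < 1 / s := by positivity
  have hq : 0 ≤ 1 - 1 / s := by linarith
  have hE : Real.exp (-1) ≤ 1 / 2 := by
    rw [Real.exp_neg, ← one_div]
    apply one_div_le_one_div_of_le (by norm_num)
    linarith [Real.exp_one_gt_d9]
  calc _ ≤ ∑ S ∈ Finset.univ.filter (fun S : Finset (Fin n) => ¬ s / 4 ≤ S.card),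
        Real.exp (s / 4) * ((Real.exp (-1) * (1 / s)) ^ S.card * (1 - 1 / s) ^ (n - S.card)) := by
        apply Finset.sum_le_sum
        intro S hS
        have hS' : ¬ s / 4 ≤ S.card := (Finset.mem_filter.1 hS).2
        push Not at hS'
        have : 1 ≤ Real.exp (s / 4) * Real.exp (-1) ^ S.card := by
          rw [← Real.exp_nat_mul, ← Real.exp_add]
          apply Real.one_le_exp; linarith
        rw [mul_pow]
        have hw : 0 ≤ (1 / s) ^ S.card * (1 - 1 / s) ^ (n - S.card) := by positivity
        nlinarith
    _ ≤ ∑ S : Finset (Fin n),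
        Real.exp (s / 4) * ((Real.exp (-1) * (1 / s)) ^ S.card * (1 - 1 / s) ^ (n - S.card)) := by
        apply Finset.sum_le_sum_of_subset_of_nonneg (Finset.filter_subset _ _)
        intros; positivity
    _ = Real.exp (s / 4) * (Real.exp (-1) * (1 / s) + (1 - 1 / s)) ^ n := by
        rw [← Finset.mul_sum]
        have := Fintype.sum_pow_mul_eq_add_pow (Fin n) (Real.exp (-1) * (1 / s)) (1 - 1 / s)
        rw [Fintype.card_fin] at this
        rw [this]
    _ ≤ Real.exp (s / 4) * Real.exp (-(1 / s) / 2) ^ n := by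
        gcongr
        have := Real.add_one_le_exp (-(1 / s) / 2)
        nlinarith
    _ = Real.exp (-s / 4) := by
        rw [← Real.exp_nat_mul, ← Real.exp_add, ← hss]; congr 1; field_simp; ring
    _ ≤ _ := Real.exp_le_exp.2 (by linarith)

/-- there exist `c > 0` and `n₀` such that for all `n ≥ n₀` and
`ε ∈ (0,1]`, if `μ ∈ ℝ^n` is random with independent coordinates, each equal to
`ε / n^(1/4)` with probability `1/√n` and `0` otherwise, then with probability at
least `1 - exp(-√n/8) - 1/n` over `μ`, the product distribution `p_μ` is at total
variation distance at least `c · ε` from the uniform distribution.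

The random draw of `μ` is encoded by the set `S` of coordinates receiving the
value `ε / n^(1/4)`, which occurs with probability
`(1/√n)^|S| · (1 - 1/√n)^(n - |S|)`. -/
theorem stmt5 : ∃ c : ℝ, 0 < c ∧ ∃ n₀ : ℕ, ∀ n : ℕ, n₀ ≤ n →
    ∀ ε : ℝ, 0 < ε → ε ≤ 1 →
    1 - Real.exp (-(Real.sqrt n) / 8) - 1 / n ≤
      ∑ S ∈ Finset.univ.filter (fun S : Finset (Fin n) =>
          c * ε ≤ tvDist n
            (prodDist n (fun i => if i ∈ S then ε / (n : ℝ) ^ ((1 : ℝ) / 4) else 0))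
            (unifDist n)),
        (1 / Real.sqrt n) ^ S.card * (1 - 1 / Real.sqrt n) ^ (n - S.card) := by
  refine ⟨1 / 16, by norm_num, 1, fun n hn ε h0 h1 => ?_⟩
  have hn' : (1 : ℝ) ≤ n := by exact_mod_cast hn
  have hs : 1 ≤ Real.sqrt n := Real.one_le_sqrt.2 hn'
  have hp1 : 1 / Real.sqrt n ≤ 1 := (div_le_one (by linarith)).2 hs
  have hq : 0 ≤ 1 - 1 / Real.sqrt n := by linarith
  have hbad := aux_bad hn
  have htot := Fintype.sum_pow_mul_eq_add_pow (Fin n) (1 / Real.sqrt n) (1 - 1 / Real.sqrt n)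
  rw [Fintype.card_fin, add_sub_cancel, one_pow,
    ← Finset.sum_filter_add_sum_filter_not Finset.univ
      (fun S : Finset (Fin n) => Real.sqrt n / 4 ≤ S.card)] at htot
  have hinv : (0 : ℝ) ≤ 1 / n := by positivity
  refine le_trans (by linarith) (Finset.sum_le_sum_of_subset_of_nonneg
    (s := Finset.univ.filter (fun S : Finset (Fin n) => Real.sqrt n / 4 ≤ S.card)) ?_ ?_)
  · intro S hS
    rw [Finset.mem_filter] at hS ⊢
    exact ⟨hS.1, aux_good hn ε h0 h1 S hS.2⟩
  · intros; positivity
end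

section
/- There exist an absolute constant C > 0 and n₀ ∈ ℕ such that for all n ≥ n₀, all ε ∈ (0,1], and all integers q with 1 ≤ q ≤ √n/(C·ε²·(log n)⁴), the following holds. Define, for (x_1,…,x_q) ∈ (ℝ^n)^q with x_{ij} the j-th coordinate of x_i: f_y(x_1,…,x_q) = (2π)^{−nq/2}·Π_{j=1}^{n} exp(−(1/2)·Σ_{i=1}^{q} x_{ij}²), and f_n(x_1,…,x_q) = (2π)^{−nq/2}·Π_{j=1}^{n} [ exp(−(1/2)·Σ_{i=1}^{q} x_{ij}²)·( 1 − 1/√n + (1/√n)·exp( (ε/n^{1/4})·Σ_{i=1}^{q} x_{ij} − q·ε²/(2√n) ) ) ]. If x_1, …, x_q are independent draws from the standard Gaussian 𝒩(0, I_n), then with probability at least 1 − 1/n − 1/√(log n): f_n(x_1,…,x_q)/f_y(x_1,…,x_q) ≥ exp( −1/(log n)^{1/4} − 1/(log n)² ). -/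
open MeasureTheory ProbabilityTheory Finset

/-- The density on `(ℝ^n)^q` of `q` i.i.d. samples from `𝒩(0, I_n)`; `x i j` is
coordinate `j` of the `i`-th sample. -/
noncomputable def fY (n q : ℕ) (x : Fin q → Fin n → ℝ) : ℝ :=
  (2 * Real.pi) ^ (-((n : ℝ) * q) / 2) *
    ∏ j : Fin n, Real.exp (-(1 / 2) * ∑ i : Fin q, (x i j) ^ 2)

/-- The density on `(ℝ^n)^q` of `q` i.i.d. samples from `𝒩(μ, I_n)` where the
coordinates of `μ` are independent, each `ε/n^(1/4)` with probability `1/√n` and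
`0` otherwise. -/
noncomputable def fN (n q : ℕ) (ε : ℝ) (x : Fin q → Fin n → ℝ) : ℝ :=
  (2 * Real.pi) ^ (-((n : ℝ) * q) / 2) *
    ∏ j : Fin n,
      (Real.exp (-(1 / 2) * ∑ i : Fin q, (x i j) ^ 2) *
        (1 - 1 / Real.sqrt n + (1 / Real.sqrt n) *
          Real.exp ((ε / (n : ℝ) ^ ((1 : ℝ) / 4)) * ∑ i : Fin q, x i j -
            (q : ℝ) * ε ^ 2 / (2 * Real.sqrt n))))

lemma swap_mp (n q : ℕ) (m : Measure ℝ) [IsProbabilityMeasure m] :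
    MeasurePreserving (fun (y : Fin n → Fin q → ℝ) i j => y j i)
      (Measure.pi (fun _ : Fin n => Measure.pi (fun _ : Fin q => m)))
      (Measure.pi (fun _ : Fin q => Measure.pi (fun _ : Fin n => m))) := by
  have hm : Measurable (fun (y : Fin n → Fin q → ℝ) (i : Fin q) (j : Fin n) => y j i) := by
    fun_prop
  refine ⟨hm, ?_⟩
  have e1 := Measure.infinitePi_map_curry_symm (ι := Fin n) (κ := Fin q) (fun _ _ => m)
  have e2 := Measure.infinitePi_map_curry (ι := Fin q) (κ := Fin n) (fun _ _ => m)
  have e3 := Measure.infinitePi_map_piCongrLeft (fun _ : Fin q × Fin n => m)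
    (Equiv.prodComm (Fin n) (Fin q))
  simp only [Measure.infinitePi_eq_pi] at e1 e2 e3
  rw [← e2, ← e3, ← e1, Measure.map_map (by fun_prop) (by fun_prop),
    Measure.map_map (by fun_prop) (by fun_prop)]
  congr 1

lemma gauss_exp (q : ℕ) (a : ℝ) :
    Integrable (fun y : Fin q → ℝ => Real.exp (a * ∑ i, y i))
      (Measure.pi (fun _ => gaussianReal 0 1)) ∧
    ∫ y : Fin q → ℝ, Real.exp (a * ∑ i, y i) ∂(Measure.pi (fun _ => gaussianReal 0 1))
      = Real.exp (q * a ^ 2 / 2) := by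
  have h : ∀ y : Fin q → ℝ, Real.exp (a * ∑ i, y i) = ∏ i, Real.exp (a * y i) := by
    intro y; rw [Finset.mul_sum, Real.exp_sum]
  simp only [h]
  constructor
  · exact Integrable.fintype_prod (f := fun _ x => Real.exp (a * x))
      (fun i => integrable_exp_mul_gaussianReal a)
  · rw [integral_fintype_prod_eq_pow (fun x => Real.exp (a * x))]
    have := mgf_gaussianReal (p := gaussianReal 0 1) (X := id) (μ := 0) (v := 1) (by simp) a
    simp only [mgf, id] at this
    rw [this, ← Real.exp_nat_mul]
    congr 1
    simp
    ring

lemma gauss_g (q : ℕ) (a p : ℝ) :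
    let g : (Fin q → ℝ) → ℝ := fun y => 1 - p + p * Real.exp (a * ∑ i, y i - q * a ^ 2 / 2)
    let m := Measure.pi (fun _ : Fin q => gaussianReal 0 1)
    Integrable g m ∧ Integrable (fun y => g y ^ 2) m ∧ ∫ y, g y ∂m = 1 ∧
      ∫ y, g y ^ 2 ∂m = 1 + p ^ 2 * (Real.exp (q * a ^ 2) - 1) := by
  intro g m
  obtain ⟨i1, e1⟩ := gauss_exp q a
  obtain ⟨i2, e2⟩ := gauss_exp q (2 * a)
  have hg : g = fun y => (1 - p) + (p * Real.exp (-(q * a ^ 2 / 2))) * Real.exp (a * ∑ i, y i) := by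
    funext y
    simp only [g, sub_eq_add_neg, Real.exp_add]
    ring
  have hg2 : (fun y => g y ^ 2) = fun y => ((1 - p) ^ 2 +
      (2 * (1 - p) * (p * Real.exp (-(q * a ^ 2 / 2)))) * Real.exp (a * ∑ i, y i)) +
      (p * Real.exp (-(q * a ^ 2 / 2))) ^ 2 * Real.exp (2 * a * ∑ i, y i) := by
    funext y
    rw [hg, mul_assoc 2 a, two_mul (a * _), Real.exp_add]
    ring
  rw [hg2, hg]
  refine ⟨(integrable_const _).add (i1.const_mul _),
    ((integrable_const _).add (i1.const_mul _)).add (i2.const_mul _), ?_, ?_⟩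
  · rw [integral_add (integrable_const _) (i1.const_mul _), integral_const_mul, e1, mul_assoc,
      ← Real.exp_add]
    simp
  · have i3 : Integrable (fun y : Fin q → ℝ => (1 - p) ^ 2 +
        (2 * (1 - p) * (p * Real.exp (-(q * a ^ 2 / 2)))) * Real.exp (a * ∑ i, y i)) m :=
      (integrable_const _).add (i1.const_mul _)
    rw [integral_add i3 (i2.const_mul _),
      integral_add (integrable_const _) (i1.const_mul _), integral_const_mul,
      integral_const_mul, e1, e2, mul_pow, ← Real.exp_nat_mul]
    have h1 : 2 * (1 - p) * (p * Real.exp (-(q * a ^ 2 / 2))) * Real.exp (q * a ^ 2 / 2)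
        = 2 * (1 - p) * p := by
      rw [← mul_assoc, mul_assoc _ (Real.exp _), ← Real.exp_add]; simp
    have h2 : p ^ 2 * Real.exp ((2 : ℕ) * (-(q * a ^ 2 / 2))) * Real.exp (q * (2 * a) ^ 2 / 2)
        = p ^ 2 * Real.exp (q * a ^ 2) := by
      rw [mul_assoc, ← Real.exp_add]; congr 2; push_cast; ring
    rw [h1, h2]
    simp
    ring

lemma prob_R (n q : ℕ) (a p c : ℝ) (hc : 0 < c) :
    (Measure.pi (fun _ : Fin q => Measure.pi (fun _ : Fin n => gaussianReal 0 1)))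
      {x | c ≤ |(∏ j : Fin n, (1 - p + p * Real.exp (a * ∑ i : Fin q, x i j - q * a ^ 2 / 2))) - 1|}
    ≤ ENNReal.ofReal (((1 + p ^ 2 * (Real.exp (q * a ^ 2) - 1)) ^ n - 1) / c ^ 2) := by
  obtain ⟨i1, i2, e1, e2⟩ := gauss_g q a p
  set g : (Fin q → ℝ) → ℝ := fun y => 1 - p + p * Real.exp (a * ∑ i, y i - q * a ^ 2 / 2) with hg
  have mg : Measurable g := by fun_prop
  rw [← (swap_mp n q (gaussianReal 0 1)).measure_preimage
    (measurableSet_le (by fun_prop) (by fun_prop)).nullMeasurableSet]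
  set M := Measure.pi (fun _ : Fin n => Measure.pi (fun _ : Fin q => gaussianReal 0 1)) with hM
  set R : (Fin n → Fin q → ℝ) → ℝ := fun y => ∏ j, g (y j) with hR
  have E1 : ∫ y, R y ∂M = 1 := by
    rw [hR, hM, integral_fintype_prod_eq_pow g, e1, one_pow]
  have hR2 : (R ^ 2) = fun y => ∏ j, (g (y j)) ^ 2 := by
    funext y; simp [hR, Finset.prod_pow]
  have E2 : ∫ y, (R ^ 2) y ∂M = (1 + p ^ 2 * (Real.exp (q * a ^ 2) - 1)) ^ n := by
    rw [hR2, hM, integral_fintype_prod_eq_pow (fun y => g y ^ 2), e2, Fintype.card_fin]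
  have I2 : Integrable (R ^ 2) M := by
    rw [hR2]
    exact Integrable.fintype_prod (f := fun _ y => g y ^ 2) (fun _ => i2)
  have mR : Measurable R := by fun_prop
  have L2 : MemLp R 2 M := (memLp_two_iff_integrable_sq mR.aestronglyMeasurable).2 I2
  have := meas_ge_le_variance_div_sq L2 hc
  rw [variance_eq_sub L2, E1, E2, one_pow] at this
  exact this

lemma ratio_eq (n q : ℕ) (ε : ℝ) (x : Fin q → Fin n → ℝ) :
    fN n q ε x / fY n q x = ∏ j : Fin n, (1 - 1 / Real.sqrt n + 1 / Real.sqrt n *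
      Real.exp ((ε / (n : ℝ) ^ ((1 : ℝ) / 4)) * ∑ i : Fin q, x i j -
        q * (ε / (n : ℝ) ^ ((1 : ℝ) / 4)) ^ 2 / 2)) := by
  unfold fN fY
  rw [Finset.prod_mul_distrib, ← mul_assoc, mul_div_cancel_left₀]
  · refine Finset.prod_congr rfl fun j _ => ?_
    congr 4
    rw [div_pow, ← Real.rpow_natCast ((n : ℝ) ^ ((1 : ℝ) / 4)), ← Real.rpow_mul (by positivity), Real.sqrt_eq_rpow]
    norm_num
    ring
  · exact (mul_pos (by positivity) (Finset.prod_pos fun _ _ => Real.exp_pos _)).ne'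

lemma var_bd (n : ℕ) (hn : 0 < n) (u : ℝ) (h0 : 0 ≤ u) (h1 : u ≤ 1 / 16) :
    (1 + (1 / Real.sqrt n) ^ 2 * (Real.exp u - 1)) ^ n - 1 ≤ 4 * u := by
  have hs : Real.exp u - 1 ≤ 2 * u := by
    have := Real.abs_exp_sub_one_le (x := u) (by rw [abs_of_nonneg h0]; linarith)
    rw [abs_of_nonneg h0] at this
    exact (le_abs_self _).trans this
  have hs0 : 0 ≤ Real.exp u - 1 := by linarith [Real.add_one_le_exp u]
  set s := Real.exp u - 1
  have he : Real.exp s - 1 ≤ 2 * s := by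
    have := Real.abs_exp_sub_one_le (x := s) (by rw [abs_of_nonneg hs0]; linarith)
    rw [abs_of_nonneg hs0] at this
    exact (le_abs_self _).trans this
  have hn' : (0 : ℝ) < n := by exact_mod_cast hn
  have : (1 + (1 / Real.sqrt n) ^ 2 * s) ^ n ≤ Real.exp s := by
    rw [div_pow, Real.sq_sqrt hn'.le]
    calc (1 + 1 ^ 2 / (n : ℝ) * s) ^ n ≤ (Real.exp (1 ^ 2 / (n : ℝ) * s)) ^ n := by
          gcongr
          linarith [Real.add_one_le_exp (1 ^ 2 / (n : ℝ) * s)]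
      _ = Real.exp s := by
          rw [← Real.exp_nat_mul]; congr 1; field_simp
  linarith

/-- there exist `C > 0` and `n₀` such that for all `n ≥ n₀`,
`ε ∈ (0,1]` and integers `q` with `1 ≤ q ≤ √n/(C ε² (log n)⁴)`, if
`x_1, …, x_q` are i.i.d. standard Gaussians `𝒩(0, I_n)` then with probability at
least `1 - 1/n - 1/√(log n)`:
`f_n(x)/f_y(x) ≥ exp(-1/(log n)^(1/4) - 1/(log n)²)`. -/
theorem stmt13 : ∃ C : ℝ, 0 < C ∧ ∃ n₀ : ℕ, ∀ n : ℕ, n₀ ≤ n →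
    ∀ ε : ℝ, 0 < ε → ε ≤ 1 → ∀ q : ℕ, 1 ≤ q →
    (q : ℝ) ≤ Real.sqrt n / (C * ε ^ 2 * (Real.log n) ^ 4) →
    ENNReal.ofReal (1 - 1 / n - 1 / Real.sqrt (Real.log n)) ≤
      Measure.pi (fun _ : Fin q => Measure.pi (fun _ : Fin n => gaussianReal 0 1))
        {x : Fin q → Fin n → ℝ |
          Real.exp (-1 / (Real.log n) ^ ((1 : ℝ) / 4) - 1 / (Real.log n) ^ 2) ≤
            fN n q ε x / fY n q x} := by
  refine ⟨16, by norm_num, 3, ?_⟩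
  intro n hn ε hε hε1 q hq hqle
  have hn3 : (3 : ℝ) ≤ n := by exact_mod_cast hn
  have hn0 : (0 : ℝ) < n := by linarith
  have hL : 1 ≤ Real.log n := by
    rw [Real.le_log_iff_exp_le hn0]
    linarith [Real.exp_one_lt_d9]
  set L := Real.log n with hLdef
  have hL0 : 0 < L := by linarith
  set a := ε / (n : ℝ) ^ ((1 : ℝ) / 4) with ha
  have ha2 : a ^ 2 = ε ^ 2 / Real.sqrt n := by
    rw [ha, div_pow, ← Real.rpow_natCast ((n : ℝ) ^ ((1 : ℝ) / 4)),
      ← Real.rpow_mul (by positivity), Real.sqrt_eq_rpow]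
    norm_num
  have hsn : 0 < Real.sqrt n := Real.sqrt_pos.2 hn0
  have hu : q * a ^ 2 ≤ 1 / (16 * L ^ 4) := by
    rw [ha2]
    calc (q : ℝ) * (ε ^ 2 / Real.sqrt n)
        ≤ Real.sqrt n / (16 * ε ^ 2 * L ^ 4) * (ε ^ 2 / Real.sqrt n) := by gcongr
      _ = 1 / (16 * L ^ 4) := by field_simp
  have hL4 : 1 ≤ L ^ 4 := one_le_pow₀ hL
  have hu1 : q * a ^ 2 ≤ 1 / 16 := by
    refine hu.trans ?_
    apply one_div_le_one_div_of_le <;> linarith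
  have hv := var_bd n (by omega) (q * a ^ 2) (by positivity) hu1
  set b := 1 / L ^ ((1 : ℝ) / 4) with hb
  have hb0 : 0 < b := by positivity
  have hb1 : b ≤ 1 := by
    rw [hb, div_le_one (by positivity)]
    exact Real.one_le_rpow hL (by norm_num)
  have hb2 : b ^ 2 = 1 / Real.sqrt L := by
    rw [hb, div_pow, ← Real.rpow_natCast (L ^ ((1 : ℝ) / 4)),
      ← Real.rpow_mul (by positivity), Real.sqrt_eq_rpow]
    norm_num
  have hsL : 0 < Real.sqrt L := Real.sqrt_pos.2 hL0
  have hP := prob_R n q a (1 / Real.sqrt n) (b / 2) (by positivity)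
  have hfin : ((1 + (1 / Real.sqrt n) ^ 2 * (Real.exp (q * a ^ 2) - 1)) ^ n - 1) / (b / 2) ^ 2
      ≤ 1 / Real.sqrt L := by
    have h1 : 4 * (q * a ^ 2) ≤ 1 / (4 * L ^ 4) := by
      calc 4 * (q * a ^ 2) ≤ 4 * (1 / (16 * L ^ 4)) := by gcongr
        _ = _ := by field_simp; norm_num
    rw [div_pow b, hb2, div_le_iff₀ (by positivity)]
    refine (hv.trans h1).trans ?_
    have hss : Real.sqrt L * Real.sqrt L = L := Real.mul_self_sqrt hL0.le
    have : 1 / Real.sqrt L * (1 / Real.sqrt L / 2 ^ 2) = 1 / (4 * L) := by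
      rw [← hss]
      field_simp
      norm_num
    rw [this]
    apply one_div_le_one_div_of_le (by positivity)
    have : L ^ 1 ≤ L ^ 4 := pow_le_pow_right₀ hL (by norm_num)
    linarith [pow_one L]
  set M := Measure.pi (fun _ : Fin q => Measure.pi (fun _ : Fin n => gaussianReal 0 1)) with hM
  set B := {x : Fin q → Fin n → ℝ | b / 2 ≤ |(∏ j : Fin n, (1 - 1 / Real.sqrt n + 1 / Real.sqrt n *
    Real.exp (a * ∑ i : Fin q, x i j - q * a ^ 2 / 2))) - 1|} with hB
  have mB : MeasurableSet B := measurableSet_le (by fun_prop) (by fun_prop)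
  have hBle : M B ≤ ENNReal.ofReal (1 / Real.sqrt L) := hP.trans (ENNReal.ofReal_le_ofReal hfin)
  calc ENNReal.ofReal (1 - 1 / n - 1 / Real.sqrt L)
      ≤ ENNReal.ofReal (1 - 1 / Real.sqrt L) := by
        apply ENNReal.ofReal_le_ofReal
        have : 0 ≤ 1 / (n : ℝ) := by positivity
        linarith
    _ = 1 - ENNReal.ofReal (1 / Real.sqrt L) := by
        rw [ENNReal.ofReal_sub _ (by positivity), ENNReal.ofReal_one]
    _ ≤ 1 - M B := tsub_le_tsub_left hBle 1
    _ = M Bᶜ := (prob_compl_eq_one_sub mB).symm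
    _ ≤ _ := by
        apply measure_mono
        intro x hx
        simp only [hB, Set.mem_compl_iff, Set.mem_ofPred_eq, not_le] at hx
        rw [Set.mem_ofPred_eq, ratio_eq]
        have h1 := (abs_lt.1 hx).1
        have h2 : Real.exp (-1 / L ^ ((1 : ℝ) / 4) - 1 / L ^ 2) ≤ Real.exp (-b) := by
          apply Real.exp_le_exp.2
          have : 0 ≤ 1 / L ^ 2 := by positivity
          rw [hb, neg_div]
          linarith
        have h3 : Real.exp (-b) ≤ 1 - b / 2 := by
          rw [Real.exp_neg]
          have h4 := Real.add_one_le_exp b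
          rw [inv_le_comm₀ (Real.exp_pos _) (by linarith)]
          refine le_trans ?_ h4
          rw [inv_le_iff_one_le_mul₀ (by linarith)]
          nlinarith
        linarith
end

section
/- There exist an absolute constant C > 0 and n₀ ∈ ℕ such that for all n ≥ n₀, all ε ∈ (0,1], and all integers q with 1 ≤ q ≤ √n/(C·ε²·(log n)⁴), the following holds. Let f_y be the density on (ℝ^n)^q of q i.i.d. samples from the standard Gaussian 𝒩(0, I_n), and let f_n be the density on (ℝ^n)^q of q i.i.d. samples from 𝒩(μ, I_n), where μ is a random vector whose coordinates are independent, each equal to ε/n^{1/4} with probability 1/√n and 0 otherwise. Then for every Borel set Y ⊆ (ℝ^n)^q with ∫_Y f_y ≥ 0.99, one has ∫_Y f_n ≥ 0.97. In particular, no procedure mapping q samples to a decision can simultaneously accept with probability at least 0.99 on samples from 𝒩(0, I_n) and reject with probability at least 0.99 on samples generated from the random mixture; hence distinguishing the two requires q > √n/(C·ε²·(log n)⁴) samples. -/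
open MeasureTheory ProbabilityTheory Finset

lemma aux_one (b : ℝ) : Integrable (fun x : ℝ => Real.exp (b * x - 1 / 2 * x ^ 2)) ∧
    ∫ x : ℝ, Real.exp (b * x - 1 / 2 * x ^ 2) = Real.sqrt (2 * Real.pi) * Real.exp (b ^ 2 / 2) := by
  have h : (fun x : ℝ => Real.exp (b * x - 1 / 2 * x ^ 2)) =
      fun x => Real.exp (b ^ 2 / 2) * (fun y => Real.exp (-(1 / 2) * y ^ 2)) (x - b) := by
    funext x
    simp only
    rw [← Real.exp_add]
    congr 1; ring
  rw [h]
  constructor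
  · exact ((integrable_exp_neg_mul_sq (by norm_num : (0 : ℝ) < 1 / 2)).comp_sub_right b).const_mul _
  · rw [integral_const_mul, integral_sub_right_eq_self (fun y => Real.exp (-(1 / 2) * y ^ 2)) b,
      integral_gaussian, mul_comm]
    congr 2
    field_simp

noncomputable def auxG (n q : ℕ) (w b : Fin 3 → ℝ) (x : Fin q → Fin n → ℝ) : ℝ :=
  (2 * Real.pi) ^ (-((n : ℝ) * q) / 2) *
    ∏ j : Fin n, (Real.exp (-(1 / 2) * ∑ i : Fin q, (x i j) ^ 2) *
      ∑ k, w k * Real.exp (b k * ∑ i : Fin q, x i j))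

lemma aux_expand (n q : ℕ) (w b : Fin 3 → ℝ) (x : Fin q → Fin n → ℝ) :
    auxG n q w b x = (2 * Real.pi) ^ (-((n : ℝ) * q) / 2) *
      ∑ κ : Fin n → Fin 3, (∏ j, w (κ j)) *
        ∏ i : Fin q, ∏ j : Fin n, Real.exp (b (κ j) * x i j - 1 / 2 * (x i j) ^ 2) := by
  unfold auxG
  congr 1
  have : ∀ j : Fin n, (Real.exp (-(1 / 2) * ∑ i : Fin q, (x i j) ^ 2) *
      ∑ k, w k * Real.exp (b k * ∑ i : Fin q, x i j)) =
      ∑ k, w k * ∏ i : Fin q, Real.exp (b k * x i j - 1 / 2 * (x i j) ^ 2) := by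
    intro j
    rw [Finset.mul_sum]
    refine Finset.sum_congr rfl fun k _ => ?_
    rw [← Real.exp_sum, Finset.sum_sub_distrib, ← Finset.mul_sum, ← Finset.mul_sum, sub_eq_add_neg,
      Real.exp_add]
    rw [neg_mul]
    ring
  simp_rw [this]
  rw [Finset.prod_univ_sum]
  simp only [Fintype.piFinset_univ]
  refine Finset.sum_congr rfl fun κ _ => ?_
  rw [Finset.prod_mul_distrib, Finset.prod_comm]

lemma aux_term (n q : ℕ) (β : Fin n → ℝ) :
    Integrable (fun x : Fin q → Fin n → ℝ =>
      ∏ i : Fin q, ∏ j : Fin n, Real.exp (β j * x i j - 1 / 2 * (x i j) ^ 2)) ∧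
    ∫ x : Fin q → Fin n → ℝ,
      ∏ i : Fin q, ∏ j : Fin n, Real.exp (β j * x i j - 1 / 2 * (x i j) ^ 2) =
      Real.sqrt (2 * Real.pi) ^ (n * q) * ∏ j, Real.exp (β j ^ 2 / 2) ^ q := by
  have h1 : Integrable (fun y : Fin n → ℝ => ∏ j : Fin n, Real.exp (β j * y j - 1 / 2 * (y j) ^ 2)) :=
    Integrable.fintype_prod (f := fun j (t : ℝ) => Real.exp (β j * t - 1 / 2 * t ^ 2))
      fun j => (aux_one (β j)).1
  constructor
  · exact Integrable.fintype_prod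
      (f := fun (_ : Fin q) (y : Fin n → ℝ) => ∏ j : Fin n, Real.exp (β j * y j - 1 / 2 * (y j) ^ 2))
      fun _ => h1
  · have e := integral_fintype_prod_volume_eq_prod (ι := Fin q) (E := fun _ => Fin n → ℝ) (𝕜 := ℝ)
      (fun (_ : Fin q) (y : Fin n → ℝ) => ∏ j : Fin n, Real.exp (β j * y j - 1 / 2 * (y j) ^ 2))
    rw [e]
    have e2 := integral_fintype_prod_volume_eq_prod (ι := Fin n) (E := fun _ => ℝ) (𝕜 := ℝ)
      (fun j (t : ℝ) => Real.exp (β j * t - 1 / 2 * t ^ 2))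
    rw [e2]
    simp_rw [fun j => (aux_one (β j)).2]
    simp only [Finset.prod_mul_distrib, Finset.prod_const, Finset.card_univ, Fintype.card_fin,
      Finset.prod_pow, mul_pow]
    rw [pow_mul]

lemma aux_G (n q : ℕ) (w b : Fin 3 → ℝ) :
    Integrable (auxG n q w b) ∧
    ∫ x, auxG n q w b x = (∑ k, w k * Real.exp (b k ^ 2 / 2) ^ q) ^ n := by
  have hf : auxG n q w b = fun x => (2 * Real.pi) ^ (-((n : ℝ) * q) / 2) *
      ∑ κ : Fin n → Fin 3, (∏ j, w (κ j)) *
        ∏ i : Fin q, ∏ j : Fin n, Real.exp (b (κ j) * x i j - 1 / 2 * (x i j) ^ 2) :=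
    funext (aux_expand n q w b)
  have hi : ∀ κ : Fin n → Fin 3, Integrable (fun x : Fin q → Fin n → ℝ => (∏ j, w (κ j)) *
        ∏ i : Fin q, ∏ j : Fin n, Real.exp (b (κ j) * x i j - 1 / 2 * (x i j) ^ 2)) :=
    fun κ => (aux_term n q (fun j => b (κ j))).1.const_mul _
  rw [hf]
  constructor
  · exact (integrable_finsetSum _ fun κ _ => hi κ).const_mul _
  · rw [integral_const_mul, integral_finsetSum _ fun κ _ => hi κ]
    simp_rw [integral_const_mul, fun κ : Fin n → Fin 3 => (aux_term n q (fun j => b (κ j))).2]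
    have hp : (2 * Real.pi) ^ (-((n : ℝ) * q) / 2) * Real.sqrt (2 * Real.pi) ^ (n * q) = 1 := by
      have h0 : (0 : ℝ) < 2 * Real.pi := by positivity
      rw [Real.sqrt_eq_rpow, ← Real.rpow_natCast, ← Real.rpow_mul h0.le, ← Real.rpow_add h0]
      convert Real.rpow_zero _ using 2
      push_cast; ring
    have hs : (∑ k, w k * Real.exp (b k ^ 2 / 2) ^ q) ^ n =
        ∑ κ : Fin n → Fin 3, (∏ j, w (κ j)) * ∏ j, Real.exp (b (κ j) ^ 2 / 2) ^ q := by
      have : (∑ k, w k * Real.exp (b k ^ 2 / 2) ^ q) ^ n =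
        ∏ _j : Fin n, (∑ k, w k * Real.exp (b k ^ 2 / 2) ^ q) := by simp
      rw [this, Finset.prod_univ_sum]
      simp only [Fintype.piFinset_univ, Finset.prod_mul_distrib]
    rw [hs, ← one_mul (∑ κ : Fin n → Fin 3, (∏ j, w (κ j)) * ∏ j, Real.exp (b (κ j) ^ 2 / 2) ^ q),
      ← hp, mul_assoc, Finset.mul_sum (a := Real.sqrt (2 * Real.pi) ^ (n * q))]
    congr 1
    refine Finset.sum_congr rfl fun κ _ => ?_
    ring

lemma aux_main (n q : ℕ) (ε : ℝ) (hn : 3 ≤ n) (hε : 0 < ε)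
    (ht : (q : ℝ) * ε ^ 2 / Real.sqrt n ≤ 1 / 100000)
    (Y : Set (Fin q → Fin n → ℝ)) (hY : MeasurableSet Y)
    (h : (0.99 : ℝ) ≤ ∫ x in Y, fY n q x) : (0.97 : ℝ) ≤ ∫ x in Y, fN n q ε x := by
  have hn0 : (0 : ℝ) < n := by exact_mod_cast (by omega : 0 < n)
  set s := Real.sqrt n with hs
  have hs0 : 0 < s := Real.sqrt_pos.2 hn0
  have hss : s ^ 2 = n := Real.sq_sqrt hn0.le
  set a := ε / (n : ℝ) ^ ((1 : ℝ) / 4) with ha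
  have ha2 : a ^ 2 = ε ^ 2 / s := by
    rw [ha, div_pow, ← Real.rpow_natCast ((n : ℝ) ^ ((1 : ℝ) / 4)), ← Real.rpow_mul hn0.le, hs,
      Real.sqrt_eq_rpow]
    norm_num
  set t := (q : ℝ) * ε ^ 2 / s with htdef
  have ht0 : 0 ≤ t := by positivity
  have hta : (q : ℝ) * a ^ 2 = t := by rw [ha2, htdef]; ring
  set p := 1 / s with hp
  have hp2 : p ^ 2 = 1 / n := by rw [hp, div_pow, hss]; norm_num
  set e := Real.exp (-(t / 2)) with he
  let b : Fin 3 → ℝ := ![0, a, 2 * a]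
  have hE : (q : ℝ) * ε ^ 2 / (2 * s) = t / 2 := by rw [htdef]; field_simp
  let Lf : (Fin q → Fin n → ℝ) → ℝ := fun x => ∏ j : Fin n, (1 - p + p * Real.exp (a * ∑ i : Fin q, x i j - t / 2))
  have hYG : fY n q = auxG n q ![1, 0, 0] b := by
    funext x
    simp [fY, auxG, Fin.sum_univ_three, b]
  have hNG : fN n q ε = auxG n q ![1 - p, p * e, 0] b := by
    funext x
    simp only [fN, auxG, Fin.sum_univ_three, b, ← hs, ← hp, ← ha, hE, sub_eq_add_neg _ (t / 2),
      Real.exp_add, ← he]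
    simp
    left
    refine Finset.prod_congr rfl fun j _ => ?_
    ring
  have hNL : ∀ x, fN n q ε x = fY n q x * Lf x := by
    intro x
    simp only [fN, fY, Lf, ← hs, ← hp, ← ha, hE, Finset.prod_mul_distrib, mul_assoc]
  have hGL : ∀ x, auxG n q ![(1 - p) ^ 2, 2 * (1 - p) * p * e, p ^ 2 * e ^ 2] b x = fY n q x * Lf x ^ 2 := by
    intro x
    simp only [auxG, fY, Lf]
    rw [← Finset.prod_pow, mul_assoc (_ ^ _) (∏ j : Fin n, _) (∏ j : Fin n, _), ← Finset.prod_mul_distrib]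
    congr 1
    refine Finset.prod_congr rfl fun j _ => ?_
    congr 1
    have h2 : Real.exp (2 * a * ∑ i : Fin q, x i j) = Real.exp (a * ∑ i : Fin q, x i j) ^ 2 := by
      rw [← Real.exp_nat_mul]; congr 1; push_cast; ring
    simp only [Fin.sum_univ_three, b, sub_eq_add_neg _ (t / 2), Real.exp_add, ← he]
    simp [h2]
    ring
  have hY0 : ∀ x, 0 ≤ fY n q x := fun x => by unfold fY; positivity
  set G := auxG n q ![(1 - p) ^ 2, 2 * (1 - p) * p * e, p ^ 2 * e ^ 2] b with hG
  have ee : e * Real.exp (a ^ 2 / 2) ^ q = 1 := by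
    rw [he, ← Real.exp_nat_mul, ← Real.exp_add]
    convert Real.exp_zero using 2
    rw [← hta]; ring
  have ee2 : e ^ 2 * Real.exp ((2 * a) ^ 2 / 2) ^ q = Real.exp t := by
    rw [he, ← Real.exp_nat_mul, ← Real.exp_nat_mul, ← Real.exp_add]
    congr 1
    rw [← hta]; push_cast; ring
  obtain ⟨iY, vY⟩ := aux_G n q ![1, 0, 0] b
  obtain ⟨iN, vN⟩ := aux_G n q ![1 - p, p * e, 0] b
  obtain ⟨iG, vG⟩ := aux_G n q ![(1 - p) ^ 2, 2 * (1 - p) * p * e, p ^ 2 * e ^ 2] b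
  rw [← hYG] at iY vY
  rw [← hNG] at iN vN
  rw [← hG] at iG vG
  have vY' : ∫ x, fY n q x = 1 := by
    rw [vY]; simp [Fin.sum_univ_three, b]
  have vN' : ∫ x, fN n q ε x = 1 := by
    rw [vN]; simp [Fin.sum_univ_three, b, mul_assoc, ee]
  have vG' : ∫ x, G x = (1 + 1 / n * (Real.exp t - 1)) ^ n := by
    rw [vG]
    congr 1
    simp only [Fin.sum_univ_three, b]
    simp [mul_assoc, ee, ee2]
    rw [← one_div, ← hp2]; ring
  have et : Real.exp t - 1 ≤ 2 / 100000 := by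
    have := Real.abs_exp_sub_one_le (x := t) (by rw [abs_of_nonneg ht0]; linarith)
    rw [abs_of_nonneg ht0] at this
    linarith [le_abs_self (Real.exp t - 1)]
  have et0 : 0 ≤ Real.exp t - 1 := by linarith [Real.add_one_le_exp t]
  have vG2 : ∫ x, G x ≤ 1 + 4 / 100000 := by
    rw [vG']
    calc (1 + 1 / n * (Real.exp t - 1)) ^ n ≤ (Real.exp (1 / n * (Real.exp t - 1))) ^ n := by
          apply pow_le_pow_left₀
          · positivity
          · linarith [Real.add_one_le_exp (1 / n * (Real.exp t - 1))]
      _ = Real.exp (Real.exp t - 1) := by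
          rw [← Real.exp_nat_mul]; congr 1; field_simp
      _ ≤ 1 + 4 / 100000 := by
          have := Real.abs_exp_sub_one_le (x := Real.exp t - 1) (by rw [abs_of_nonneg et0]; linarith)
          rw [abs_of_nonneg et0] at this
          linarith [le_abs_self (Real.exp (Real.exp t - 1) - 1)]
  have iD : Integrable (fun x => G x - 2 * fN n q ε x + fY n q x) := (iG.sub (iN.const_mul 2)).add iY
  have vD : ∫ x, (G x - 2 * fN n q ε x + fY n q x) ≤ 4 / 100000 := by
    have iS : Integrable (fun x => G x - 2 * fN n q ε x) := iG.sub (iN.const_mul 2)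
    rw [integral_add iS iY, integral_sub iG (iN.const_mul 2),
      integral_const_mul, vY', vN']
    linarith
  have vDY : ∫ x in Y, (G x - 2 * fN n q ε x + fY n q x) ≤ 4 / 100000 := by
    refine le_trans (setIntegral_le_integral iD (Filter.Eventually.of_forall fun x => ?_)) vD
    show 0 ≤ G x - 2 * fN n q ε x + fY n q x
    rw [hGL, hNL]
    nlinarith [mul_nonneg (hY0 x) (sq_nonneg (Lf x - 1))]
  have key : ∫ x in Y, (0.995 * fY n q x - 50 * (G x - 2 * fN n q ε x + fY n q x)) ≤
      ∫ x in Y, fN n q ε x := by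
    refine setIntegral_mono ((iY.const_mul _).sub (iD.const_mul _)).integrableOn iN.integrableOn ?_
    intro x
    show 0.995 * fY n q x - 50 * (G x - 2 * fN n q ε x + fY n q x) ≤ fN n q ε x
    rw [hGL, hNL]
    nlinarith [mul_nonneg (hY0 x) (sq_nonneg (Lf x - 1 + 0.01))]
  rw [integral_sub (iY.const_mul _).integrableOn (iD.const_mul _).integrableOn,
    integral_const_mul, integral_const_mul] at key
  linarith

/-- there exist `C > 0` and `n₀` such that for all `n ≥ n₀`,
`ε ∈ (0,1]` and integers `q` with `1 ≤ q ≤ √n/(C ε² (log n)⁴)`, the following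
holds: for every Borel set `Y ⊆ (ℝ^n)^q` with `∫_Y f_y ≥ 0.99` one has
`∫_Y f_n ≥ 0.97`.  (Hence no tester using `q` samples can accept samples from
`𝒩(0, I_n)` with probability `≥ 0.99` while rejecting samples from the random
mixture with probability `≥ 0.99`.) -/
theorem stmt14 : ∃ C : ℝ, 0 < C ∧ ∃ n₀ : ℕ, ∀ n : ℕ, n₀ ≤ n →
    ∀ ε : ℝ, 0 < ε → ε ≤ 1 → ∀ q : ℕ, 1 ≤ q →
    (q : ℝ) ≤ Real.sqrt n / (C * ε ^ 2 * (Real.log n) ^ 4) →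
    ∀ Y : Set (Fin q → Fin n → ℝ), MeasurableSet Y →
    (0.99 : ℝ) ≤ ∫ x in Y, fY n q x →
    (0.97 : ℝ) ≤ ∫ x in Y, fN n q ε x := by
  refine ⟨100000, by norm_num, 3, ?_⟩
  intro n hn ε hε _ q _ hq Y hY h
  refine aux_main n q ε hn hε ?_ Y hY h
  have hn3 : (3 : ℝ) ≤ n := by exact_mod_cast hn
  have hs0 : 0 < Real.sqrt n := Real.sqrt_pos.2 (by linarith)
  have hl : 1 ≤ Real.log n := by
    rw [Real.le_log_iff_exp_le (by linarith)]
    linarith [Real.exp_one_lt_d9]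
  have hl4 : 1 ≤ Real.log n ^ 4 := one_le_pow₀ hl
  rw [le_div_iff₀ (by positivity)] at hq
  rw [div_le_iff₀ hs0]
  have : (q : ℝ) * ε ^ 2 * 1 ≤ (q : ℝ) * ε ^ 2 * Real.log n ^ 4 :=
    mul_le_mul_of_nonneg_left hl4 (by positivity)
  nlinarith
end
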